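/- Let μ and ν be compactly supported Borel probability measures on ℝ, neither of which is a point mass. Let ω₁, ω₂ : ℂ⁺ → ℂ⁺ be analytic with lim_{y→+∞} ω_j(iy)/(iy) = 1 for j = 1, 2 and ω₁(z) + ω₂(z) − z = F_μ(ω₁(z)) = F_ν(ω₂(z)) for all z ∈ ℂ⁺, and let σ be a Borel probability measure on ℝ such that G_σ(z) = 1/(ω₁(z) + ω₂(z) − z) for all z ∈ ℂ⁺. Suppose that ω₁ extends meromorphically to a neighborhood of a point x ∈ ℝ and that there is δ > 0 with ω₁(y) ∈ ℝ for every y ∈ (x−δ, x+δ)∖{x}. If x ∈ supp(σ), then x is an isolated atom of σ: σ({x}) > 0 and there exists δ' > 0 with σ((x−δ', x+δ')∖{x}) = 0. -/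

import Mathlib

open MeasureTheory Filter Metric

/-- The Cauchy–Stieltjes transform `G_μ(z) = ∫ 1/(z-t) dμ(t)` of a measure on `ℝ`. -/
noncomputable def cauchyT (μ : Measure ℝ) (z : ℂ) : ℂ :=
  ∫ t, (z - (t : ℂ))⁻¹ ∂μ

/-- The (topological) support of a Borel measure on `ℝ`. -/
def msupp (μ : Measure ℝ) : Set ℝ :=
  {x : ℝ | ∀ r : ℝ, 0 < r → 0 < μ (Metric.ball x r)}

open Topology

section CauchyTransform

variable {μ : Measure ℝ} [IsProbabilityMeasure μ] {z w : ℂ}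

lemma sub_ofReal_ne_zero (hz : 0 < z.im) (t : ℝ) : z - (t : ℂ) ≠ 0 := fun h => by
  have := congrArg Complex.im h
  simp at this
  exact hz.ne' this

lemma norm_sub_ofReal_inv_le (hz : 0 < z.im) (t : ℝ) : ‖(z - (t : ℂ))⁻¹‖ ≤ z.im⁻¹ := by
  rw [norm_inv]
  refine inv_anti₀ hz ?_
  have := Complex.abs_im_le_norm (z - (t : ℂ))
  simp only [Complex.sub_im, Complex.ofReal_im, sub_zero] at this
  exact (le_abs_self _).trans this

lemma measurable_sub_ofReal_inv (z : ℂ) : Measurable fun t : ℝ => (z - (t : ℂ))⁻¹ := by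
  fun_prop

lemma integrable_sub_ofReal_inv (hz : 0 < z.im) :
    Integrable (fun t : ℝ => (z - (t : ℂ))⁻¹) μ :=
  .of_bound (measurable_sub_ofReal_inv z).aestronglyMeasurable z.im⁻¹
    (.of_forall (norm_sub_ofReal_inv_le hz))

lemma integrable_norm_sub_ofReal_inv_sq (hz : 0 < z.im) :
    Integrable (fun t : ℝ => ‖(z - (t : ℂ))⁻¹‖ ^ 2) μ := by
  refine .of_bound ((measurable_sub_ofReal_inv z).norm.pow_const 2).aestronglyMeasurable
    (z.im⁻¹ ^ 2) (.of_forall fun t => ?_)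
  rw [Real.norm_of_nonneg (by positivity)]
  gcongr
  exact norm_sub_ofReal_inv_le hz t

lemma im_sub_ofReal_inv (z : ℂ) (t : ℝ) :
    (z - (t : ℂ))⁻¹.im = -z.im * ‖(z - (t : ℂ))⁻¹‖ ^ 2 := by
  rw [Complex.inv_im, norm_inv, inv_pow, Complex.sq_norm]
  simp [div_eq_mul_inv]

lemma im_cauchyT (hz : 0 < z.im) :
    (cauchyT μ z).im = -z.im * ∫ t : ℝ, ‖(z - (t : ℂ))⁻¹‖ ^ 2 ∂μ := by
  have h := integral_im (𝕜 := ℂ) (integrable_sub_ofReal_inv (μ := μ) hz)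
  rw [cauchyT, ← integral_const_mul]
  simp_rw [← im_sub_ofReal_inv]
  exact h.symm

lemma integral_norm_sub_ofReal_inv_sq_pos (hz : 0 < z.im) :
    0 < ∫ t : ℝ, ‖(z - (t : ℂ))⁻¹‖ ^ 2 ∂μ := by
  rw [integral_pos_iff_support_of_nonneg (fun t => by positivity)
    (integrable_norm_sub_ofReal_inv_sq hz)]
  have : Function.support (fun t : ℝ => ‖(z - (t : ℂ))⁻¹‖ ^ 2) = Set.univ := by
    ext t
    simpa using sub_ofReal_ne_zero hz t
  rw [this]
  simp

lemma im_cauchyT_neg (hz : 0 < z.im) : (cauchyT μ z).im < 0 := by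
  rw [im_cauchyT hz]
  nlinarith [mul_pos hz (integral_norm_sub_ofReal_inv_sq_pos (μ := μ) hz)]

lemma cauchyT_ne_zero (hz : 0 < z.im) : cauchyT μ z ≠ 0 := fun h => by
  have := im_cauchyT_neg (μ := μ) hz
  simp [h] at this

lemma continuousAt_cauchyT (hz : 0 < z.im) : ContinuousAt (cauchyT μ) z := by
  refine continuousAt_of_dominated (bound := fun _ => (z.im / 2)⁻¹)
    (.of_forall fun w => (measurable_sub_ofReal_inv w).aestronglyMeasurable) ?_
    (integrable_const _) (.of_forall fun t => ?_)
  · have : ∀ᶠ w in 𝓝 z, z.im / 2 < w.im :=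
      Complex.continuous_im.continuousAt.eventually_const_lt (by linarith)
    filter_upwards [this] with w hw
    have hw0 : 0 < w.im := by linarith
    exact .of_forall fun t => (norm_sub_ofReal_inv_le hw0 t).trans
      (inv_anti₀ (by linarith) hw.le)
  · exact (continuousAt_id.sub continuousAt_const).inv₀ (sub_ofReal_ne_zero hz t)

/-- Strict Cauchy–Schwarz for the resolvent kernel of a non-degenerate measure. -/
lemma norm_cauchyT_sq_lt (hμ : ∀ c : ℝ, μ ≠ Measure.dirac c) (hz : 0 < z.im) :
    ‖cauchyT μ z‖ ^ 2 < ∫ t : ℝ, ‖(z - (t : ℂ))⁻¹‖ ^ 2 ∂μ := by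
  set c := cauchyT μ z with hc
  have hi := integrable_sub_ofReal_inv (μ := μ) hz
  have hi2 := integrable_norm_sub_ofReal_inv_sq (μ := μ) hz
  have hre : Integrable (fun t : ℝ => 2 * (starRingEnd ℂ c * (z - (t : ℂ))⁻¹).re) μ :=
    ((hi.const_mul _).re).const_mul _
  have hexp : ∀ t : ℝ, ‖(z - (t : ℂ))⁻¹ - c‖ ^ 2 =
      ‖(z - (t : ℂ))⁻¹‖ ^ 2 - 2 * (starRingEnd ℂ c * (z - (t : ℂ))⁻¹).re + ‖c‖ ^ 2 := by
    intro t
    simp only [Complex.sq_norm, Complex.normSq_apply, Complex.sub_re, Complex.sub_im,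
      Complex.mul_re, Complex.conj_re, Complex.conj_im]
    ring
  have hint : Integrable (fun t : ℝ => ‖(z - (t : ℂ))⁻¹ - c‖ ^ 2) μ := by
    simp_rw [hexp]
    exact (hi2.sub hre).add (integrable_const _)
  have hval : ∫ t : ℝ, ‖(z - (t : ℂ))⁻¹ - c‖ ^ 2 ∂μ =
      (∫ t : ℝ, ‖(z - (t : ℂ))⁻¹‖ ^ 2 ∂μ) - ‖c‖ ^ 2 := by
    have h1 : ∫ t : ℝ, 2 * (starRingEnd ℂ c * (z - (t : ℂ))⁻¹).re ∂μ = 2 * ‖c‖ ^ 2 := by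
      rw [integral_const_mul]
      have h := integral_re (𝕜 := ℂ) (hi.const_mul (starRingEnd ℂ c))
      rw [integral_const_mul] at h
      have h' : (starRingEnd ℂ c * c).re = ‖c‖ ^ 2 := by
        rw [Complex.conj_mul', ← Complex.ofReal_pow, Complex.ofReal_re]
      rw [← h']
      exact congrArg _ h
    simp_rw [hexp]
    have h2 := integral_add (hi2.sub hre) (integrable_const (‖c‖ ^ 2))
    have h3 := integral_sub hi2 hre
    simp only [Pi.sub_apply] at h2
    rw [h2, h3, h1]
    simp
    ring
  have hnn : 0 ≤ ∫ t : ℝ, ‖(z - (t : ℂ))⁻¹ - c‖ ^ 2 ∂μ :=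
    integral_nonneg fun t => sq_nonneg _
  rcases hnn.lt_or_eq with h | h
  · linarith
  · exfalso
    have hae := (integral_eq_zero_iff_of_nonneg (fun t => sq_nonneg _) hint).1 h.symm
    have hae' : ∀ᵐ t ∂μ, t = (z - c⁻¹).re := by
      filter_upwards [hae] with t ht
      have : (z - (t : ℂ))⁻¹ = c := by simpa [sub_eq_zero] using ht
      rw [← this, inv_inv]
      simp
    refine hμ (z - c⁻¹).re ?_
    have h1 : μ.map id = μ.map fun _ => (z - c⁻¹).re := Measure.map_congr hae'
    rw [Measure.map_id, Measure.map_const] at h1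
    simpa using h1

lemma im_lt_im_inv_cauchyT (hμ : ∀ c : ℝ, μ ≠ Measure.dirac c) (hz : 0 < z.im) :
    z.im < (cauchyT μ z)⁻¹.im := by
  have hG : 0 < ‖cauchyT μ z‖ ^ 2 := by
    have := norm_pos_iff.2 (cauchyT_ne_zero (μ := μ) hz)
    positivity
  rw [Complex.inv_im, ← Complex.sq_norm, im_cauchyT hz, lt_div_iff₀ hG]
  nlinarith [mul_lt_mul_of_pos_left (norm_cauchyT_sq_lt hμ hz) hz]

/-- The Cauchy transform of a compactly supported measure is small far away. -/
lemma norm_cauchyT_le_of_add_le_norm {m M : ℝ} (hm : μ (Set.Icc (-m) m)ᶜ = 0)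
    (hM : 0 < M) (hz : m + M ≤ ‖z‖) : ‖cauchyT μ z‖ ≤ M⁻¹ := by
  have hae : ∀ᵐ t : ℝ ∂μ, ‖(z - (t : ℂ))⁻¹‖ ≤ M⁻¹ := by
    have : ∀ᵐ t ∂μ, t ∈ Set.Icc (-m) m := hm
    filter_upwards [this] with t ht
    rw [norm_inv]
    refine inv_anti₀ hM ?_
    have h1 := norm_sub_norm_le z (t : ℂ)
    rw [Complex.norm_real] at h1
    have h2 : ‖t‖ ≤ m := abs_le.2 ht
    linarith
  simpa [cauchyT] using norm_integral_le_of_norm_le_const hae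

/-- `1 - ‖(G + i) / (G - i)‖²`, which measures the distance of `G` to the extended real line. -/
noncomputable def defect (μ : Measure ℝ) (z : ℂ) : ℝ :=
  -4 * (cauchyT μ z).im / ‖cauchyT μ z - Complex.I‖ ^ 2

/-- The Cayley transform of the Cauchy transform. -/
noncomputable def cayleyT (μ : Measure ℝ) (z : ℂ) : ℂ :=
  1 + 2 * Complex.I / (cauchyT μ z - Complex.I)

lemma one_lt_norm_cauchyT_sub_I (hz : 0 < z.im) : 1 < ‖cauchyT μ z - Complex.I‖ := by
  have h := Complex.abs_im_le_norm (cauchyT μ z - Complex.I)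
  have h' := im_cauchyT_neg (μ := μ) hz
  simp only [Complex.sub_im, Complex.I_im] at h
  rw [abs_of_neg (by linarith)] at h
  linarith

lemma cauchyT_sub_I_ne_zero (hz : 0 < z.im) : cauchyT μ z - Complex.I ≠ 0 :=
  norm_pos_iff.1 (one_pos.trans (one_lt_norm_cauchyT_sub_I hz))

lemma norm_cayleyT_sq (hz : 0 < z.im) : ‖cayleyT μ z‖ ^ 2 = 1 - defect μ z := by
  have hne := cauchyT_sub_I_ne_zero (μ := μ) hz
  have h : cayleyT μ z = (cauchyT μ z + Complex.I) / (cauchyT μ z - Complex.I) := by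
    rw [cayleyT, eq_div_iff hne, add_mul, div_mul_cancel₀ _ hne]
    ring
  have hpos : ‖cauchyT μ z - Complex.I‖ ^ 2 ≠ 0 := by simpa using hne
  rw [h, defect, norm_div, div_pow, eq_sub_iff_add_eq, ← add_div, div_eq_one_iff_eq hpos]
  simp only [Complex.sq_norm, Complex.normSq_apply, Complex.add_re, Complex.sub_re,
    Complex.add_im, Complex.sub_im, Complex.I_re, Complex.I_im]
  ring

lemma defect_pos (hz : 0 < z.im) : 0 < defect μ z := by
  have h1 := im_cauchyT_neg (μ := μ) hz
  have h2 := one_lt_norm_cauchyT_sub_I (μ := μ) hz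
  exact div_pos (by linarith) (by positivity)

lemma defect_eq (hz : 0 < z.im) :
    defect μ z / z.im = 4 * ∫ t : ℝ, (‖(z - (t : ℂ))⁻¹‖ / ‖cauchyT μ z - Complex.I‖) ^ 2 ∂μ := by
  simp_rw [div_pow]
  rw [integral_div, defect, im_cauchyT hz]
  field_simp

lemma norm_cayleyT_sub_le (hz : 0 < z.im) (hw : 0 < w.im) :
    ‖cayleyT μ z - cayleyT μ w‖ ≤ ‖z - w‖ * (defect μ z / z.im + defect μ w / w.im) / 4 := by
  have hGz := cauchyT_sub_I_ne_zero (μ := μ) hz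
  have hGw := cauchyT_sub_I_ne_zero (μ := μ) hw
  have h1 : cayleyT μ z - cayleyT μ w =
      2 * Complex.I * (cauchyT μ w - cauchyT μ z) /
        ((cauchyT μ z - Complex.I) * (cauchyT μ w - Complex.I)) := by
    simp only [cayleyT]
    field_simp
    ring
  have h2 : cauchyT μ w - cauchyT μ z =
      (z - w) * ∫ t : ℝ, (z - (t : ℂ))⁻¹ * (w - (t : ℂ))⁻¹ ∂μ := by
    rw [cauchyT, cauchyT, ← integral_sub (integrable_sub_ofReal_inv hw)
      (integrable_sub_ofReal_inv hz), ← integral_const_mul]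
    refine integral_congr_ae (.of_forall fun t => ?_)
    have := sub_ofReal_ne_zero hz t
    have := sub_ofReal_ne_zero hw t
    simp only
    field_simp
    ring
  set a := ‖cauchyT μ z - Complex.I‖ with ha
  set b := ‖cauchyT μ w - Complex.I‖ with hb
  have ha0 : 0 < a := norm_pos_iff.2 hGz
  have hb0 : 0 < b := norm_pos_iff.2 hGw
  have hia : Integrable (fun t : ℝ => (‖(z - (t : ℂ))⁻¹‖ / a) ^ 2) μ := by
    simp_rw [div_pow]
    exact (integrable_norm_sub_ofReal_inv_sq hz).div_const _
  have hib : Integrable (fun t : ℝ => (‖(w - (t : ℂ))⁻¹‖ / b) ^ 2) μ := by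
    simp_rw [div_pow]
    exact (integrable_norm_sub_ofReal_inv_sq hw).div_const _
  have h3 : ‖∫ t : ℝ, (z - (t : ℂ))⁻¹ * (w - (t : ℂ))⁻¹ ∂μ‖ ≤
      ∫ t : ℝ, a * b / 2 * ((‖(z - (t : ℂ))⁻¹‖ / a) ^ 2 + (‖(w - (t : ℂ))⁻¹‖ / b) ^ 2) ∂μ := by
    refine norm_integral_le_of_norm_le ((hia.add hib).const_mul _) (.of_forall fun t => ?_)
    rw [norm_mul]
    have e : ‖(z - (t : ℂ))⁻¹‖ * ‖(w - (t : ℂ))⁻¹‖ =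
        a * b / 2 * (2 * (‖(z - (t : ℂ))⁻¹‖ / a) * (‖(w - (t : ℂ))⁻¹‖ / b)) := by
      field_simp
    rw [e]
    gcongr
    exact two_mul_le_add_sq _ _
  rw [integral_const_mul, integral_add hia hib] at h3
  rw [h1, h2, defect_eq hz, defect_eq hw]
  simp only [norm_div, norm_mul, Complex.norm_I, Complex.norm_ofNat, mul_one, ← ha, ← hb]
  rw [div_le_iff₀ (by positivity)]
  have h4 := mul_le_mul_of_nonneg_left h3 (norm_nonneg (z - w))
  linarith

end CauchyTransform

lemma norm_cayleyT_sub_one {μ : Measure ℝ} (z : ℂ) : ‖cayleyT μ z - 1‖ =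
    2 / ‖cauchyT μ z - Complex.I‖ := by
  simp [cayleyT]

/-- A boundary Hopf-type estimate: if `‖φ‖ → 1` uniformly at a real interval, then
`1 - ‖φ‖²` vanishes at least linearly there. -/
lemma exists_one_sub_norm_sq_le_mul_im {φ : ℂ → ℂ} {x R : ℝ} (hR : 0 < R)
    (hd : DifferentiableOn ℂ φ {z | 0 < z.im})
    (h : ∀ κ > 0, ∃ η > 0, ∀ z : ℂ, 0 < z.im → z.im < η → |z.re - x| ≤ 2 * R → 1 - κ ≤ ‖φ z‖) :
    ∃ r > 0, r ≤ R ∧ ∃ C > 0, ∀ z : ℂ, 0 < z.im → z.im < r → |z.re - x| < r →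
      1 - ‖φ z‖ ^ 2 ≤ C * z.im := by
  obtain ⟨η₀, hη₀, h₀⟩ := h (1 / 2) (by norm_num)
  obtain ⟨r, hr, hrR, hrη⟩ : ∃ r > 0, r ≤ R ∧ r < η₀ :=
    ⟨min R (η₀ / 2), by positivity, min_le_left _ _, (min_le_right _ _).trans_lt (by linarith)⟩
  refine ⟨r, hr, hrR, 4 / r, by positivity, fun z hz hzr hzx => ?_⟩
  have key : ∀ κ > 0, κ ≤ 1 / 2 → 1 - κ ≤ ‖φ z‖ * Real.exp (2 * z.im / r) := by
    intro κ hκ hκ2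
    obtain ⟨η, hη, hη'⟩ := h κ hκ
    obtain ⟨η₁, hη₁, hη₁η, hη₁z⟩ : ∃ η₁ > 0, η₁ < η ∧ η₁ < z.im :=
      ⟨min (η / 2) (z.im / 2), by positivity, (min_le_left _ _).trans_lt (by linarith),
        (min_le_right _ _).trans_lt (by linarith)⟩
    set B : ℂ → ℂ := fun w => ((w - z.re) ^ 2 - 2 * r * Complex.I * (w - z.re)) / (r ^ 2 : ℝ) with hB
    have hBre : ∀ w, (B w).re = ((w.re - z.re) ^ 2 - w.im ^ 2 + 2 * r * w.im) / r ^ 2 := by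
      intro w
      simp only [hB]
      rw [Complex.div_ofReal_re]
      congr 1
      simp [sq]
    set f : ℂ → ℂ := fun w => (φ w)⁻¹ * Complex.exp (-B w) with hf
    set U : Set ℂ := ball (z.re : ℂ) r ∩ {w | η₁ < w.im} with hU
    have hUo : IsOpen U := isOpen_ball.inter (isOpen_lt continuous_const Complex.continuous_im)
    have hUc : closure U ⊆ closedBall (z.re : ℂ) r ∩ {w | η₁ ≤ w.im} :=
      closure_minimal (fun w hw => ⟨ball_subset_closedBall hw.1, le_of_lt (α := ℝ) hw.2⟩)
        (isClosed_closedBall.inter (isClosed_le continuous_const Complex.continuous_im))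
    have hclose : ∀ w ∈ closedBall (z.re : ℂ) r, |w.re - z.re| ≤ r ∧ |w.im| ≤ r := by
      intro w hw
      rw [mem_closedBall, Complex.dist_eq] at hw
      exact ⟨by simpa using (Complex.abs_re_le_norm _).trans hw,
        by simpa using (Complex.abs_im_le_norm _).trans hw⟩
    have hre : ∀ w ∈ closedBall (z.re : ℂ) r, |w.re - x| ≤ 2 * R := fun w hw => by
      have := abs_sub_le w.re z.re x
      linarith [(hclose w hw).1]
    have hlow : ∀ w ∈ closure U, 1 / 2 ≤ ‖φ w‖ := fun w hw => by
      have hw' := hUc hw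
      have him : η₁ ≤ w.im := hw'.2
      have := h₀ w (by linarith) (by linarith [le_abs_self w.im, (hclose w hw'.1).2])
        (hre w hw'.1)
      linarith
    have hfd : DiffContOnCl ℂ f U := by
      refine DifferentiableOn.diffContOnCl fun w hw => DifferentiableAt.differentiableWithinAt ?_
      have him : η₁ ≤ w.im := (hUc hw).2
      have hφ : DifferentiableAt ℂ φ w := hd.differentiableAt
        ((isOpen_lt continuous_const Complex.continuous_im).mem_nhds (hη₁.trans_le him))
      have hne : φ w ≠ 0 := norm_pos_iff.1 (by linarith [hlow w hw])
      have hBd : DifferentiableAt ℂ B w := by fun_prop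
      exact (hφ.inv hne).mul hBd.neg.cexp
    have hnorm : ∀ w, ‖f w‖ = ‖φ w‖⁻¹ * Real.exp (-(B w).re) := fun w => by
      simp [hf, Complex.norm_exp]
    have hκ1 : 1 ≤ (1 - κ)⁻¹ := (one_le_inv₀ (by linarith)).2 (by linarith)
    have hfr : ∀ w ∈ frontier U, ‖f w‖ ≤ (1 - κ)⁻¹ := by
      intro w hw
      rw [hUo.frontier_eq] at hw
      obtain ⟨hwc, hwU⟩ := hw
      obtain ⟨hwb, hwi⟩ := hUc hwc
      have hwi : η₁ ≤ w.im := hwi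
      have hwim : w.im ≤ r := (le_abs_self _).trans (hclose w hwb).2
      rw [hnorm]
      by_cases hwr : dist w (z.re : ℂ) < r
      · have hwe : w.im = η₁ := le_antisymm (not_lt.1 fun hlt => hwU ⟨hwr, hlt⟩) hwi
        have h1 : 1 - κ ≤ ‖φ w‖ := hη' w (by linarith) (by linarith) (hre w hwb)
        have h2 : 0 ≤ (B w).re := by
          rw [hBre]
          refine div_nonneg ?_ (by positivity)
          nlinarith [sq_nonneg (w.re - z.re)]
        calc ‖φ w‖⁻¹ * Real.exp (-(B w).re) ≤ (1 - κ)⁻¹ * 1 := by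
              gcongr
              · linarith
              · exact Real.exp_le_one_iff.2 (by linarith)
          _ = _ := mul_one _
      · have hwe : dist w (z.re : ℂ) = r := le_antisymm hwb (not_lt.1 hwr)
        have hsq : (w.re - z.re) ^ 2 + w.im ^ 2 = r ^ 2 := by
          rw [← hwe, Complex.dist_eq, Complex.sq_norm, Complex.normSq_apply]
          simp [sq]
        have h2 : 1 ≤ (B w).re := by
          rw [hBre, one_le_div (by positivity)]
          nlinarith
        have h3 : Real.exp (-(B w).re) ≤ 1 / 2 := by
          have e1 := Real.exp_le_exp.2 (neg_le_neg h2)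
          have e2 : Real.exp (-1) ≤ 1 / 2 := by
            rw [Real.exp_neg, one_div]
            exact inv_anti₀ (by norm_num) (by linarith [Real.add_one_le_exp (1 : ℝ)])
          exact e1.trans e2
        have h4 : ‖φ w‖⁻¹ ≤ 2 := by
          have := inv_anti₀ (by norm_num) (hlow w hwc)
          norm_num at this
          exact this
        calc ‖φ w‖⁻¹ * Real.exp (-(B w).re) ≤ 2 * (1 / 2) := by gcongr
          _ ≤ (1 - κ)⁻¹ := by linarith
    have hzU : z ∈ U := by
      refine ⟨?_, hη₁z⟩
      have : z - (z.re : ℂ) = (z.im : ℂ) * Complex.I := by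
        apply Complex.ext <;> simp
      rw [mem_ball, Complex.dist_eq, this]
      simpa [abs_of_pos hz] using hzr
    have hfz := Complex.norm_le_of_forall_mem_frontier_norm_le
      (isBounded_ball.subset Set.inter_subset_left) hfd hfr (subset_closure hzU)
    have hφz : 0 < ‖φ z‖ := by linarith [hlow z (subset_closure hzU)]
    have hBz : (B z).re ≤ 2 * z.im / r := by
      rw [hBre, div_le_div_iff₀ (by positivity) hr]
      nlinarith [mul_pos hr (mul_pos hz hz)]
    have h5 : Real.exp (-(2 * z.im / r)) * ‖φ z‖⁻¹ ≤ (1 - κ)⁻¹ := by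
      refine le_trans ?_ hfz
      rw [hnorm, mul_comm]
      gcongr
    rw [Real.exp_neg, ← mul_inv] at h5
    have := (inv_le_inv₀ (by positivity) (by linarith)).1 h5
    linarith
  have h1 : 1 ≤ ‖φ z‖ * Real.exp (2 * z.im / r) := by
    by_contra! hlt
    have := key (min (1 / 2) ((1 - ‖φ z‖ * Real.exp (2 * z.im / r)) / 2))
      (lt_min (by norm_num) (by linarith)) (min_le_left _ _)
    linarith [min_le_right (1 / 2) ((1 - ‖φ z‖ * Real.exp (2 * z.im / r)) / 2)]
  have h2 : Real.exp (-(2 * z.im / r)) ≤ ‖φ z‖ := by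
    rw [Real.exp_neg]
    exact (inv_le_iff_one_le_mul₀ (Real.exp_pos _)).2 h1
  have h3 : Real.exp (-(4 / r * z.im)) ≤ ‖φ z‖ ^ 2 := by
    calc Real.exp (-(4 / r * z.im)) = Real.exp (-(2 * z.im / r)) ^ 2 := by
          rw [← Real.exp_nat_mul]
          congr 1
          push_cast
          ring
      _ ≤ _ := by gcongr
  linarith [Real.add_one_le_exp (-(4 / r * z.im))]

/-- A measure giving mass `O(s²)` to short intervals of length `2s` vanishes. -/
lemma measure_Icc_eq_zero_of_sq_bound {σ : Measure ℝ} [IsFiniteMeasure σ] {y ρ s₁ K : ℝ}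
    (hρ : 0 < ρ) (hs₁ : 0 < s₁)
    (h : ∀ t s : ℝ, |t - y| < ρ → 0 < s → s < s₁ → σ.real (Set.Icc (t - s) (t + s)) ≤ K * s ^ 2) :
    σ (Set.Icc (y - ρ / 2) (y + ρ / 2)) = 0 := by
  have hK : 0 ≤ K := by
    have := measureReal_nonneg.trans
      (h y (s₁ / 2) (by simpa using hρ) (by linarith) (by linarith))
    exact nonneg_of_mul_nonneg_left this (by positivity)
  have hbd : ∀ᶠ n : ℕ in atTop,
      σ.real (Set.Icc (y - ρ / 2) (y + ρ / 2)) ≤ 2 * K * ρ ^ 2 / n := by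
    have hlim := tendsto_const_div_atTop_nhds_zero_nat ρ
    filter_upwards [hlim.eventually_lt_const hs₁, eventually_ge_atTop 1] with n hn hn1
    have hn0 : (1 : ℝ) ≤ n := by exact_mod_cast hn1
    have hnpos : (0 : ℝ) < n := by linarith
    have hs : 0 < ρ / n := by positivity
    have hcov : Set.Icc (y - ρ / 2) (y + ρ / 2) ⊆ ⋃ k ∈ Finset.range (n + 1),
        Set.Icc (y - ρ / 2 + k * (ρ / n) - ρ / n) (y - ρ / 2 + k * (ρ / n) + ρ / n) := by
      intro u hu
      have hu0 : 0 ≤ (u - (y - ρ / 2)) / (ρ / n) := div_nonneg (by linarith [hu.1]) hs.le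
      have hfl := Nat.floor_le hu0
      have hfl' := Nat.lt_floor_add_one ((u - (y - ρ / 2)) / (ρ / n))
      rw [le_div_iff₀ hs] at hfl
      rw [div_lt_iff₀ hs] at hfl'
      simp only [Set.mem_iUnion]
      refine ⟨⌊(u - (y - ρ / 2)) / (ρ / n)⌋₊, ?_, by linarith, by linarith⟩
      rw [Finset.mem_range, Nat.lt_succ_iff]
      refine Nat.floor_le_of_le ?_
      rw [div_le_iff₀ hs, mul_div_cancel₀ _ hnpos.ne']
      linarith [hu.2]
    calc σ.real (Set.Icc (y - ρ / 2) (y + ρ / 2))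
        ≤ ∑ k ∈ Finset.range (n + 1), σ.real
            (Set.Icc (y - ρ / 2 + k * (ρ / n) - ρ / n) (y - ρ / 2 + k * (ρ / n) + ρ / n)) :=
          (measureReal_mono hcov (measure_ne_top _ _)).trans (measureReal_biUnion_finset_le _ _)
      _ ≤ ∑ k ∈ Finset.range (n + 1), K * (ρ / n) ^ 2 := by
          refine Finset.sum_le_sum fun k hk => h _ _ ?_ hs hn
          have hk' : (k : ℝ) ≤ n := by
            exact_mod_cast Nat.lt_succ_iff.1 (Finset.mem_range.1 hk)
          have h1 : (k : ℝ) * (ρ / n) ≤ n * (ρ / n) := by gcongr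
          rw [mul_div_cancel₀ _ hnpos.ne'] at h1
          have h2 : 0 ≤ (k : ℝ) * (ρ / n) := by positivity
          rw [abs_lt]
          constructor <;> linarith
      _ = (n + 1) * (K * (ρ / n) ^ 2) := by simp
      _ ≤ (2 * n) * (K * (ρ / n) ^ 2) := by gcongr; linarith
      _ = 2 * K * ρ ^ 2 / n := by field_simp
  have hle := ge_of_tendsto (tendsto_const_div_atTop_nhds_zero_nat (2 * K * ρ ^ 2)) hbd
  exact (measureReal_eq_zero_iff).1 (le_antisymm hle measureReal_nonneg)

section Atoms

variable {σ : Measure ℝ} [IsProbabilityMeasure σ]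

lemma measureReal_Icc_le_im_cauchyT {z : ℂ} (hz : 0 < z.im) :
    σ.real (Set.Icc (z.re - z.im) (z.re + z.im)) ≤ 2 * z.im * -(cauchyT σ z).im := by
  have hM := mul_meas_ge_le_integral_of_nonneg (μ := σ)
    (.of_forall fun t : ℝ => sq_nonneg ‖(z - (t : ℂ))⁻¹‖)
    (integrable_norm_sub_ofReal_inv_sq hz) (2 * z.im ^ 2)⁻¹
  have hsub : Set.Icc (z.re - z.im) (z.re + z.im) ⊆
      {t : ℝ | (2 * z.im ^ 2)⁻¹ ≤ ‖(z - (t : ℂ))⁻¹‖ ^ 2} := by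
    intro t ht
    have hne := sub_ofReal_ne_zero hz t
    rw [Set.mem_ofPred_eq, norm_inv, inv_pow]
    refine inv_anti₀ (by positivity) ?_
    rw [Complex.sq_norm, Complex.normSq_apply]
    simp only [Complex.sub_re, Complex.ofReal_re, Complex.sub_im, Complex.ofReal_im, sub_zero]
    nlinarith [ht.1, ht.2]
  have h1 := (mul_le_mul_of_nonneg_left (measureReal_mono (μ := σ) hsub)
    (inv_nonneg.2 (by positivity))).trans hM
  rw [inv_mul_le_iff₀ (by positivity)] at h1
  rw [im_cauchyT hz]
  linarith

lemma tendsto_integral_mul_norm_inv (y : ℝ) :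
    Tendsto (fun s : ℝ => ∫ t : ℝ, s * ‖((y : ℂ) + s * Complex.I - (t : ℂ))⁻¹‖ ∂σ) (𝓝[>] 0)
      (𝓝 (σ.real {y})) := by
  rw [← integral_indicator_one (measurableSet_singleton y)]
  refine tendsto_integral_filter_of_dominated_convergence (fun _ => 1) ?_ ?_
    (integrable_const _) (.of_forall fun t => ?_)
  · exact .of_forall fun s =>
      ((measurable_sub_ofReal_inv _).norm.const_mul _).aestronglyMeasurable
  · filter_upwards [self_mem_nhdsWithin] with s hs
    have hs : 0 < s := hs
    refine .of_forall fun t => ?_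
    have h1 := norm_sub_ofReal_inv_le (z := (y : ℂ) + s * Complex.I) (by simpa using hs) t
    rw [Real.norm_of_nonneg (by positivity)]
    calc _ ≤ s * s⁻¹ := by
          gcongr
          simpa using h1
      _ = 1 := mul_inv_cancel₀ hs.ne'
  · by_cases hty : t = y
    · subst hty
      refine tendsto_const_nhds.congr' ?_
      filter_upwards [self_mem_nhdsWithin] with s hs
      have hs : 0 < s := hs
      simp [abs_of_pos hs, hs.ne']
    · have hne : (y : ℂ) - t ≠ 0 := by
        rw [sub_ne_zero]
        exact_mod_cast Ne.symm hty
      have hc : ContinuousAt (fun s : ℝ => s * ‖((y : ℂ) + s * Complex.I - (t : ℂ))⁻¹‖) 0 := by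
        refine continuousAt_id.mul (ContinuousAt.norm (ContinuousAt.inv₀ (by fun_prop) ?_))
        simpa using hne
      have := hc.tendsto.mono_left (nhdsWithin_le_nhds (s := Set.Ioi 0))
      simpa [hty] using this

lemma two_div_le_measureReal_singleton {y R L : ℝ} (hR : 0 < R) (hL : 0 < L)
    (h : ∀ s : ℝ, 0 < s → s < R → ‖cayleyT σ ((y : ℂ) + s * Complex.I) - 1‖ ≤ L * s) :
    2 / L ≤ σ.real {y} := by
  have hlim : Tendsto (fun s : ℝ => s +
      ∫ t : ℝ, s * ‖((y : ℂ) + s * Complex.I - (t : ℂ))⁻¹‖ ∂σ) (𝓝[>] 0)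
      (𝓝 (0 + σ.real {y})) :=
    (tendsto_id.mono_left nhdsWithin_le_nhds).add (tendsto_integral_mul_norm_inv y)
  rw [zero_add] at hlim
  refine ge_of_tendsto hlim ?_
  filter_upwards [Ioo_mem_nhdsGT hR] with s hs
  have h1 := h s hs.1 hs.2
  have hz : 0 < ((y : ℂ) + s * Complex.I).im := by simpa using hs.1
  have h2 := one_lt_norm_cauchyT_sub_I (μ := σ) hz
  rw [norm_cayleyT_sub_one, div_le_iff₀ (by linarith)] at h1
  have h3 : ‖cauchyT σ ((y : ℂ) + s * Complex.I) - Complex.I‖ ≤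
      (∫ t : ℝ, ‖((y : ℂ) + s * Complex.I - (t : ℂ))⁻¹‖ ∂σ) + 1 := by
    refine (norm_sub_le _ _).trans ?_
    rw [Complex.norm_I]
    gcongr
    exact norm_integral_le_integral_norm _
  rw [integral_const_mul, div_le_iff₀ hL]
  have h4 := mul_le_mul_of_nonneg_left h3 (mul_pos hL hs.1).le
  linarith

end Atoms

lemma exists_punctured_Ioo_measure_zero {σ : Measure ℝ} [IsProbabilityMeasure σ] {x r C : ℝ}
    (hr : 0 < r) (hC : 0 < C)
    (hq : ∀ z : ℂ, 0 < z.im → z.im < r → |z.re - x| < r → defect σ z ≤ C * z.im) :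
    ∃ δ' : ℝ, 0 < δ' ∧ σ (Set.Ioo (x - δ') (x + δ') \ {x}) = 0 := by
  obtain ⟨L, hL, hLC⟩ : ∃ L > 0, L = C / 2 := ⟨C / 2, by positivity, rfl⟩
  have hlip : ∀ z w : ℂ, 0 < z.im → z.im < r → |z.re - x| < r → 0 < w.im → w.im < r →
      |w.re - x| < r → ‖cayleyT σ z - cayleyT σ w‖ ≤ L * ‖z - w‖ := by
    intro z w hz hzr hzx hw hwr hwx
    have h1 : defect σ z / z.im ≤ C := (div_le_iff₀ hz).2 (hq z hz hzr hzx)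
    have h2 : defect σ w / w.im ≤ C := (div_le_iff₀ hw).2 (hq w hw hwr hwx)
    calc _ ≤ ‖z - w‖ * (defect σ z / z.im + defect σ w / w.im) / 4 := norm_cayleyT_sub_le hz hw
      _ ≤ ‖z - w‖ * (C + C) / 4 := by gcongr
      _ = L * ‖z - w‖ := by rw [hLC]; ring
  set E : Set ℝ := {y | |y - x| < r ∧ ∀ s : ℝ, 0 < s → s < r →
    ‖cayleyT σ ((y : ℂ) + s * Complex.I) - 1‖ ≤ L * s} with hE
  have hEfin : E.Finite := by
    by_contra hinf
    refine measure_ne_top σ E (Set.Infinite.meas_eq_top hinf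
      ⟨ENNReal.ofReal (2 / L), by simpa using hL, fun y hy => ?_⟩)
    exact ENNReal.ofReal_le_of_le_toReal (two_div_le_measureReal_singleton hr hL hy.2)
  have hnull : ∀ y, |y - x| < r → y ∉ E → ∃ ρ > 0, σ (Set.Icc (y - ρ / 2) (y + ρ / 2)) = 0 := by
    intro y hy hyE
    simp only [hE, Set.mem_ofPred_eq, not_and, not_forall, not_le] at hyE
    obtain ⟨s₀, hs₀, hs₀r, hs₀L⟩ := hyE hy
    obtain ⟨η, hη, hηe⟩ : ∃ η > 0,
        ‖cayleyT σ ((y : ℂ) + s₀ * Complex.I) - 1‖ = L * s₀ + η :=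
      ⟨_, sub_pos.2 hs₀L, by ring⟩
    obtain ⟨ρ, hρ, hρr, hρη⟩ : ∃ ρ > 0, ρ ≤ r - |y - x| ∧ ρ ≤ η / (2 * L) :=
      ⟨min (r - |y - x|) (η / (2 * L)), lt_min (by linarith) (by positivity),
        min_le_left _ _, min_le_right _ _⟩
    refine ⟨ρ, hρ, measure_Icc_eq_zero_of_sq_bound (s₁ := s₀) (K := 8 * C / η ^ 2) hρ hs₀ ?_⟩
    intro t s ht hs hss
    have htx : |t - x| < r := (abs_sub_le t y x).trans_lt (by linarith)
    have hz : 0 < ((t : ℂ) + s * Complex.I).im := by simpa using hs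
    have h1 := hlip ((t : ℂ) + s * Complex.I) ((y : ℂ) + s₀ * Complex.I) hz
      (by simpa using hss.trans hs₀r) (by simpa using htx) (by simpa using hs₀)
      (by simpa using hs₀r) (by simpa using hy)
    have h2 : ‖(t : ℂ) + s * Complex.I - ((y : ℂ) + s₀ * Complex.I)‖ ≤ ρ + s₀ := by
      refine (Complex.norm_le_abs_re_add_abs_im _).trans ?_
      have : |s - s₀| ≤ s₀ := by rw [abs_le]; constructor <;> linarith
      simpa using add_le_add ht.le this
    have h3 : η / 2 ≤ ‖cayleyT σ ((t : ℂ) + s * Complex.I) - 1‖ := by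
      have e1 := norm_sub_le_norm_sub_add_norm_sub (cayleyT σ ((y : ℂ) + s₀ * Complex.I))
        (cayleyT σ ((t : ℂ) + s * Complex.I)) 1
      rw [norm_sub_rev (cayleyT σ ((y : ℂ) + s₀ * Complex.I)) (cayleyT σ _), hηe] at e1
      have e2 : L * ρ ≤ η / 2 := by
        rw [le_div_iff₀ (by positivity)] at hρη
        linarith
      have e3 := mul_le_mul_of_nonneg_left h2 hL.le
      linarith
    have h4 := hq _ hz (by simpa using hss.trans hs₀r) (by simpa using htx)
    have h5 : -(cauchyT σ ((t : ℂ) + s * Complex.I)).im ≤ 4 * C / η ^ 2 * s := by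
      have hg := one_lt_norm_cauchyT_sub_I (μ := σ) hz
      rw [norm_cayleyT_sub_one, le_div_iff₀ (by linarith)] at h3
      rw [defect, div_le_iff₀ (by positivity)] at h4
      have him : ((t : ℂ) + s * Complex.I).im = s := by simp
      rw [him] at h4
      have h6 : ‖cauchyT σ ((t : ℂ) + s * Complex.I) - Complex.I‖ ^ 2 ≤ (4 / η) ^ 2 := by
        gcongr
        rw [le_div_iff₀ hη]
        linarith
      have h7 := mul_le_mul_of_nonneg_left h6 (mul_pos hC hs).le
      calc _ ≤ C * s * (4 / η) ^ 2 / 4 := by linarith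
        _ = _ := by ring
    have h8 := measureReal_Icc_le_im_cauchyT (σ := σ) hz
    simp only [Complex.add_re, Complex.ofReal_re, Complex.mul_re, Complex.I_re, mul_zero,
      Complex.ofReal_im, Complex.I_im, mul_one, sub_zero, add_zero, Complex.add_im,
      Complex.mul_im, zero_add] at h8
    calc _ ≤ _ := h8
      _ ≤ 2 * s * (4 * C / η ^ 2 * s) := by gcongr
      _ = _ := by ring
  have hopen : (E \ {x})ᶜ ∈ 𝓝 x :=
    (hEfin.subset Set.sdiff_subset).isClosed.isOpen_compl.mem_nhds (by simp)
  obtain ⟨d, hd, hdE⟩ := Metric.mem_nhds_iff.1 hopen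
  refine ⟨min d r, lt_min hd hr, measure_null_of_locally_null _ fun y hy => ?_⟩
  have hyb : |y - x| < min d r := by
    rw [abs_sub_lt_iff]
    constructor <;> linarith [hy.1.1, hy.1.2]
  have hyE : y ∉ E := fun h => hdE (Metric.mem_ball.2 (hyb.trans_le (min_le_left _ _))) ⟨h, hy.2⟩
  obtain ⟨ρ, hρ, h0⟩ := hnull y (hyb.trans_le (min_le_right _ _)) hyE
  exact ⟨_, mem_nhdsWithin_of_mem_nhds (Icc_mem_nhds (by linarith) (by linarith)), h0⟩

section Subordination

variable {μ ν σ : Measure ℝ} [IsProbabilityMeasure μ] [IsProbabilityMeasure ν]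
  [IsProbabilityMeasure σ]

lemma defect_le_norm_cauchyT {z : ℂ} (hz : 0 < z.im) : defect σ z ≤ 4 * ‖cauchyT σ z‖ := by
  have h1 := one_lt_norm_cauchyT_sub_I (μ := σ) hz
  have h2 := (neg_le_abs _).trans (Complex.abs_im_le_norm (cauchyT σ z))
  have h3 := le_mul_of_one_le_right (norm_nonneg (cauchyT σ z)) (one_le_pow₀ h1.le (n := 2))
  rw [defect, div_le_iff₀ (by positivity)]
  linarith

lemma defect_le_im_inv_cauchyT {z : ℂ} (hz : 0 < z.im) :
    defect σ z ≤ 4 * (cauchyT σ z)⁻¹.im := by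
  have h1 := im_cauchyT_neg (μ := σ) hz
  have h2 : 0 < ‖cauchyT σ z‖ ^ 2 := by
    have := norm_pos_iff.2 (cauchyT_ne_zero (μ := σ) hz)
    positivity
  have h3 : ‖cauchyT σ z‖ ^ 2 ≤ ‖cauchyT σ z - Complex.I‖ ^ 2 := by
    simp only [Complex.sq_norm, Complex.normSq_apply, Complex.sub_re, Complex.sub_im,
      Complex.I_re, Complex.I_im]
    linarith
  rw [defect, Complex.inv_im, ← Complex.sq_norm, mul_div_assoc', mul_neg, ← neg_mul]
  exact div_le_div_of_nonneg_left (by linarith) h2 h3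

/-- If `ω₁` approaches the extended real line at a real point `y`, so does `G_σ`. -/
lemma eventually_defect_lt
    (hμc : ∃ m : ℝ, μ (Set.Icc (-m) m)ᶜ = 0) (hνc : ∃ m : ℝ, ν (Set.Icc (-m) m)ᶜ = 0)
    (hνd : ∀ c : ℝ, ν ≠ Measure.dirac c) {ω₁ ω₂ : ℂ → ℂ}
    (hsub : ∀ z : ℂ, 0 < z.im →
      ω₁ z + ω₂ z - z = (cauchyT μ (ω₁ z))⁻¹ ∧ ω₁ z + ω₂ z - z = (cauchyT ν (ω₂ z))⁻¹)
    (hσ : ∀ z : ℂ, 0 < z.im → cauchyT σ z = (ω₁ z + ω₂ z - z)⁻¹) {y : ℂ}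
    (hy : Tendsto (fun z => (ω₁ z).im) (𝓝[{z : ℂ | 0 < z.im}] y) (𝓝 0) ∨
      Tendsto ω₁ (𝓝[{z : ℂ | 0 < z.im}] y) (Bornology.cobounded ℂ)) {κ : ℝ} (hκ : 0 < κ) :
    ∀ᶠ z in 𝓝[{z : ℂ | 0 < z.im}] y, defect σ z < κ := by
  have hGμ : ∀ z : ℂ, 0 < z.im → cauchyT σ z = cauchyT μ (ω₁ z) := fun z hz => by
    rw [hσ z hz, (hsub z hz).1, inv_inv]
  have hGν : ∀ z : ℂ, 0 < z.im → cauchyT σ z = cauchyT ν (ω₂ z) := fun z hz => by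
    rw [hσ z hz, (hsub z hz).2, inv_inv]
  have hM : 0 < 8 / κ := by positivity
  rcases hy with hy | hy
  · obtain ⟨m, hm⟩ := hνc
    set K : Set ℂ := closedBall 0 (m + 8 / κ) ∩ {w | κ / 16 ≤ w.im} with hK
    have hKc : IsCompact K := (isCompact_closedBall _ _).inter_right
      (isClosed_le continuous_const Complex.continuous_im)
    have hKpos : ∀ w ∈ K, 0 < w.im := fun w hw => lt_of_lt_of_le (by positivity) hw.2
    obtain ⟨c, hc, hcK⟩ := hKc.exists_forall_le' (a := 0)
      (f := fun w => (cauchyT ν w)⁻¹.im - w.im)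
      (fun w hw => ContinuousAt.continuousWithinAt
        ((Complex.continuous_im.continuousAt.comp ((continuousAt_cauchyT (hKpos w hw)).inv₀
          (cauchyT_ne_zero (hKpos w hw)))).sub Complex.continuous_im.continuousAt))
      (fun w hw => sub_pos.2 (im_lt_im_inv_cauchyT hνd (hKpos w hw)))
    filter_upwards [self_mem_nhdsWithin, hy.eventually_lt_const hc,
      hy.eventually_lt_const (show 0 < κ / 16 by positivity)] with z hz hzc hzκ
    have hz : 0 < z.im := hz
    rcases le_or_gt (m + 8 / κ) ‖ω₂ z‖ with hbig | hsmall
    · have h1 := norm_cauchyT_le_of_add_le_norm hm hM hbig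
      rw [← hGν z hz, inv_div] at h1
      linarith [defect_le_norm_cauchyT (σ := σ) hz]
    · have him : (ω₂ z).im < κ / 16 := by
        by_contra! hge
        have h1 := hcK (ω₂ z) ⟨by simpa using hsmall.le, hge⟩
        rw [← (hsub z hz).2] at h1
        simp only [Complex.sub_im, Complex.add_im] at h1
        linarith
      have h1 := defect_le_im_inv_cauchyT (σ := σ) hz
      rw [hσ z hz, inv_inv] at h1
      simp only [Complex.sub_im, Complex.add_im] at h1
      linarith
  · obtain ⟨m, hm⟩ := hμc
    have hn := (tendsto_norm_atTop_iff_cobounded.2 hy).eventually_ge_atTop (m + 8 / κ)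
    filter_upwards [self_mem_nhdsWithin, hn] with z hz hbig
    have hz : 0 < z.im := hz
    have h1 := norm_cauchyT_le_of_add_le_norm hm hM hbig
    rw [← hGμ z hz, inv_div] at h1
    linarith [defect_le_norm_cauchyT (σ := σ) hz]

end Subordination

/-- A function meromorphic at a real point and real-valued on the punctured real line nearby
approaches the extended real line at all nearby real points. -/
lemma exists_tendsto_im_zero_or_cobounded {Ω : ℂ → ℂ} {x δ : ℝ} (hδ : 0 < δ)
    (hΩ : MeromorphicAt Ω (x : ℂ))
    (hreal : ∀ y : ℝ, y ≠ x → |y - x| < δ → (Ω (y : ℂ)).im = 0) :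
    ∃ R > 0, ∀ y : ℝ, |y - x| < R →
      Tendsto (fun z => (Ω z).im) (𝓝[{z : ℂ | 0 < z.im}] (y : ℂ)) (𝓝 0) ∨
      Tendsto Ω (𝓝[{z : ℂ | 0 < z.im}] (y : ℂ)) (Bornology.cobounded ℂ) := by
  obtain ⟨e, he, hea⟩ := Metric.eventually_nhds_iff.1
    (eventually_nhdsWithin_iff.1 hΩ.eventually_analyticAt)
  refine ⟨min e δ, lt_min he hδ, fun y hy => ?_⟩
  have hye : |y - x| < e := hy.trans_le (min_le_left _ _)
  have hyδ : |y - x| < δ := hy.trans_le (min_le_right _ _)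
  by_cases hyx : y = x
  · subst hyx
    have hle : 𝓝[{z : ℂ | 0 < z.im}] (y : ℂ) ≤ 𝓝[≠] (y : ℂ) :=
      nhdsWithin_mono _ fun z hz h => by
        rw [Set.mem_singleton_iff] at h
        simp [h] at hz
    rcases le_or_gt 0 (meromorphicOrderAt Ω (y : ℂ)) with ho | ho
    · obtain ⟨c, hc⟩ := tendsto_nhds_of_meromorphicOrderAt_nonneg hΩ ho
      have hci := (Complex.continuous_im.tendsto c).comp hc
      have hemb : Tendsto (fun t : ℝ => (t : ℂ)) (𝓝[≠] y) (𝓝[≠] (y : ℂ)) :=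
        tendsto_nhdsWithin_of_tendsto_nhds_of_eventually_within _
          ((Complex.continuous_ofReal.tendsto y).mono_left nhdsWithin_le_nhds) <| by
            filter_upwards [self_mem_nhdsWithin] with t ht
            simpa using ht
      have h0 : Tendsto (fun t : ℝ => (Ω (t : ℂ)).im) (𝓝[≠] y) (𝓝 0) := by
        refine tendsto_const_nhds.congr' ?_
        filter_upwards [self_mem_nhdsWithin,
          mem_nhdsWithin_of_mem_nhds (Metric.ball_mem_nhds y hδ)] with t ht htb
        exact (hreal t ht htb).symm
      have hc0 : c.im = 0 := tendsto_nhds_unique (hci.comp hemb) h0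
      rw [hc0] at hci
      exact .inl (hci.mono_left hle)
    · exact .inr ((tendsto_cobounded_of_meromorphicOrderAt_neg ho).mono_left hle)
  · have han : AnalyticAt ℂ Ω (y : ℂ) := hea
      (by rw [Complex.dist_eq, ← Complex.ofReal_sub, Complex.norm_real]; exact hye)
      (by simpa using hyx)
    have h := (Complex.continuous_im.continuousAt.comp han.continuousAt).tendsto
    simp only [Function.comp_apply, hreal y hyx hyδ] at h
    exact .inl (h.mono_left nhdsWithin_le_nhds)

/-- if the subordination function `ω₁` of `σ = μ ⊞ ν` extends meromorphically
through a real point `x` with real values on a punctured real neighbourhood of `x`, and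
`x ∈ supp(σ)`, then `x` is an isolated atom of `σ`. -/
theorem stmt16 (μ ν : Measure ℝ) [IsProbabilityMeasure μ] [IsProbabilityMeasure ν]
    (hμc : ∃ m : ℝ, μ (Set.Icc (-m) m)ᶜ = 0) (hνc : ∃ m : ℝ, ν (Set.Icc (-m) m)ᶜ = 0)
    (hμd : ∀ c : ℝ, μ ≠ Measure.dirac c) (hνd : ∀ c : ℝ, ν ≠ Measure.dirac c)
    (ω₁ ω₂ : ℂ → ℂ)
    (hω₁a : DifferentiableOn ℂ ω₁ {z : ℂ | 0 < z.im})
    (hω₂a : DifferentiableOn ℂ ω₂ {z : ℂ | 0 < z.im})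
    (hω₁m : ∀ z : ℂ, 0 < z.im → 0 < (ω₁ z).im)
    (hω₂m : ∀ z : ℂ, 0 < z.im → 0 < (ω₂ z).im)
    (hω₁l : Tendsto (fun y : ℝ => ω₁ (y * Complex.I) / (y * Complex.I)) atTop (nhds 1))
    (hω₂l : Tendsto (fun y : ℝ => ω₂ (y * Complex.I) / (y * Complex.I)) atTop (nhds 1))
    (hsub : ∀ z : ℂ, 0 < z.im →
      ω₁ z + ω₂ z - z = (cauchyT μ (ω₁ z))⁻¹ ∧ ω₁ z + ω₂ z - z = (cauchyT ν (ω₂ z))⁻¹)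
    (σ : Measure ℝ) [IsProbabilityMeasure σ]
    (hσ : ∀ z : ℂ, 0 < z.im → cauchyT σ z = (ω₁ z + ω₂ z - z)⁻¹)
    (x : ℝ) (ε : ℝ) (hε : 0 < ε) (Ω₁ : ℂ → ℂ)
    (hΩ₁ : MeromorphicOn Ω₁ (Metric.ball (x : ℂ) ε))
    (hagree : ∀ z ∈ Metric.ball (x : ℂ) ε, 0 < z.im → Ω₁ z = ω₁ z)
    (δ : ℝ) (hδ : 0 < δ)
    (hreal : ∀ y : ℝ, y ≠ x → |y - x| < δ → (Ω₁ (y : ℂ)).im = 0)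
    (hxsupp : x ∈ msupp σ) :
    0 < σ {x} ∧ ∃ δ' : ℝ, 0 < δ' ∧ σ (Set.Ioo (x - δ') (x + δ') \ {x}) = 0 := by
  suffices h : ∃ δ' : ℝ, 0 < δ' ∧ σ (Set.Ioo (x - δ') (x + δ') \ {x}) = 0 by
    refine ⟨?_, h⟩
    obtain ⟨δ', hδ', h0⟩ := h
    have h1 := hxsupp δ' hδ'
    rw [Real.ball_eq_Ioo] at h1
    rw [pos_iff_ne_zero]
    intro hx0
    refine h1.ne' (measure_mono_null (fun t ht => ?_) (measure_union_null h0 hx0))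
    by_cases htx : t = x
    · exact .inr htx
    · exact .inl ⟨ht, htx⟩
  obtain ⟨R₀, hR₀, hΩ⟩ := exists_tendsto_im_zero_or_cobounded hδ
    (hΩ₁ x (Metric.mem_ball_self hε)) hreal
  obtain ⟨R, hR, hRR₀, hRε⟩ : ∃ R > 0, 2 * R < R₀ ∧ 2 * R < ε :=
    ⟨min R₀ ε / 4, by positivity, by linarith [min_le_left R₀ ε, lt_min hR₀ hε],
      by linarith [min_le_right R₀ ε, lt_min hR₀ hε]⟩
  have hloc : ∀ κ > 0, ∀ y : ℝ, |y - x| ≤ 2 * R →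
      ∀ᶠ z in 𝓝 (y : ℂ), 0 < z.im → defect σ z < κ := by
    intro κ hκ y hy
    have hev : Ω₁ =ᶠ[𝓝[{z : ℂ | 0 < z.im}] (y : ℂ)] ω₁ := by
      have hyb : (y : ℂ) ∈ Metric.ball (x : ℂ) ε := by
        rw [Metric.mem_ball, Complex.dist_eq, ← Complex.ofReal_sub, Complex.norm_real]
        exact hy.trans_lt hRε
      filter_upwards [self_mem_nhdsWithin,
        mem_nhdsWithin_of_mem_nhds (Metric.isOpen_ball.mem_nhds hyb)] with z hz hzb
      exact hagree z hzb hz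
    exact eventually_nhdsWithin_iff.1 (eventually_defect_lt hμc hνc hνd hsub hσ
      ((hΩ y (hy.trans_lt hRR₀)).imp
        (fun h => h.congr' (hev.mono fun z hz => congrArg Complex.im hz))
        (fun h => h.congr' hev)) hκ)
  have hunif : ∀ κ > 0, ∃ η > 0, ∀ z : ℂ, 0 < z.im → z.im < η → |z.re - x| ≤ 2 * R →
      1 - κ ≤ ‖cayleyT σ z‖ := by
    intro κ hκ
    have hK : IsCompact (Complex.ofReal '' Metric.closedBall x (2 * R)) :=
      (isCompact_closedBall _ _).image Complex.continuous_ofReal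
    have hev : ∀ᶠ z in 𝓝ˢ (Complex.ofReal '' Metric.closedBall x (2 * R)),
        0 < z.im → defect σ z < κ := by
      rw [eventually_nhdsSet_iff_forall]
      rintro _ ⟨y, hy, rfl⟩
      exact hloc κ hκ y hy
    obtain ⟨η, hη, hηs⟩ := (Metric.hasBasis_nhdsSet_thickening hK).eventually_iff.1 hev
    refine ⟨η, hη, fun z hz hzη hzx => ?_⟩
    have hmem : z ∈ Metric.thickening η (Complex.ofReal '' Metric.closedBall x (2 * R)) := by
      refine Metric.mem_thickening_iff.2 ⟨(z.re : ℂ), ⟨z.re, hzx, rfl⟩, ?_⟩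
      have : z - (z.re : ℂ) = (z.im : ℂ) * Complex.I := by
        apply Complex.ext <;> simp
      rw [Complex.dist_eq, this]
      simpa [abs_of_pos hz] using hzη
    have h1 := hηs hmem hz
    have h2 := norm_cayleyT_sq (μ := σ) hz
    have h3 := defect_pos (μ := σ) hz
    by_contra! hlt
    nlinarith [norm_nonneg (cayleyT σ z)]
  have hd : DifferentiableOn ℂ (cayleyT σ) {z | 0 < z.im} := by
    have hF : ∀ z ∈ {z : ℂ | 0 < z.im}, ω₁ z + ω₂ z - z ≠ 0 := fun z hz h => by
      refine cauchyT_ne_zero (μ := σ) hz ?_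
      rw [hσ z hz, h, inv_zero]
    have hG : DifferentiableOn ℂ (cauchyT σ) {z | 0 < z.im} :=
      (((hω₁a.add hω₂a).sub differentiableOn_id).inv hF).congr fun z hz => hσ z hz
    exact ((differentiableOn_const _).div (hG.sub_const _)
      fun z hz => cauchyT_sub_I_ne_zero hz).const_add _
  obtain ⟨r, hr, -, C, hC, hrC⟩ := exists_one_sub_norm_sq_le_mul_im hR hd hunif
  refine exists_punctured_Ioo_measure_zero hr hC fun z hz hzr hzx => ?_
  have h1 := hrC z hz hzr hzx
  rw [norm_cayleyT_sq hz] at h1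
  linarith
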